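/- arXiv:2009.03056 — 2 statements merged into one kernel-verified Lean document; each statement's English description precedes it below -/
import Mathlib

section
/- Let S ⊆ ℤ^m be a vector monoid, A ⊆ S finite, C = cone(A), S_C = S ∩ C, L₀ = C ∩ (−C), L = lin(C), A₀ = {x ∈ A : −x ∈ S_C}, A₁ = A \ A₀. If a ∈ A₁, then S_C = T + gp(A₀) + ⋃_{a ∈ B ∈ 𝓑} sg(B), where T is some finite subset of S_C and 𝓑 is the set of all B ⊆ A₁ such that (x + L₀ : x ∈ B) is a basis of the quotient space L/L₀. -/
open Set Filter Topology MeasureTheory ProbabilityTheory Pointwise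

noncomputable section

/-- Coercion of an integer vector to a real vector. -/
def zc {m : ℕ} (x : Fin m → ℤ) : Fin m → ℝ := fun i => (x i : ℝ)

/-- Convex conical hull: all finite nonnegative real combinations of elements of `A`. -/
def coneHull {m : ℕ} (A : Set (Fin m → ℝ)) : Set (Fin m → ℝ) :=
  { x | ∃ (s : Finset (Fin m → ℝ)) (w : (Fin m → ℝ) → ℝ),
      ↑s ⊆ A ∧ (∀ a ∈ s, 0 ≤ w a) ∧ x = ∑ a ∈ s, w a • a }

/-- `S_C = S ∩ cone(A)`. -/
def SC {m : ℕ} (S : Set (Fin m → ℤ)) (A : Finset (Fin m → ℤ)) : Set (Fin m → ℤ) :=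
  {x ∈ S | zc x ∈ coneHull (zc '' (A : Set (Fin m → ℤ)))}

/-- `A₀ = {x ∈ A : −x ∈ S_C}`. -/
def A0 {m : ℕ} (S : Set (Fin m → ℤ)) (A : Finset (Fin m → ℤ)) : Set (Fin m → ℤ) :=
  {x ∈ (A : Set (Fin m → ℤ)) | -x ∈ SC S A}

/-- Lineality space `L₀ = C ∩ (−C)` of `C = cone(A)`, as a submodule (it is a linear
subspace, so taking the span does not change it). -/
def L0 {m : ℕ} (A : Finset (Fin m → ℤ)) : Submodule ℝ (Fin m → ℝ) :=
  Submodule.span ℝ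
    (coneHull (zc '' (A : Set (Fin m → ℤ))) ∩ (-(coneHull (zc '' (A : Set (Fin m → ℤ))))))

/-- `L = lin(C) = lin(A)`. -/
def Lsp {m : ℕ} (A : Finset (Fin m → ℤ)) : Submodule ℝ (Fin m → ℝ) :=
  Submodule.span ℝ (zc '' (A : Set (Fin m → ℤ)))

def inC {m : ℕ} (A : Finset (Fin m → ℤ)) (x : Fin m → ℝ) : Prop :=
  ∃ w : (Fin m → ℤ) → ℝ, (∀ b, 0 ≤ w b) ∧ x = ∑ b ∈ A, w b • zc b

theorem zc_inj {m : ℕ} : Function.Injective (zc : (Fin m → ℤ) → (Fin m → ℝ)) := by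
  intro x y h
  funext i
  have := congrFun h i
  simpa [zc] using this

theorem zc_add {m : ℕ} (x y : Fin m → ℤ) : zc (x + y) = zc x + zc y := by
  funext i; simp [zc]

theorem zc_neg {m : ℕ} (x : Fin m → ℤ) : zc (-x) = -zc x := by
  funext i; simp [zc]

theorem zc_zero {m : ℕ} : zc (0 : Fin m → ℤ) = 0 := by
  funext i; simp [zc]

theorem mem_cone_iff {m : ℕ} (A : Finset (Fin m → ℤ)) (x : Fin m → ℝ) :
    x ∈ coneHull (zc '' (A : Set (Fin m → ℤ))) ↔ inC A x := by
  classical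
  constructor
  · rintro ⟨s, w, hs, hw, rfl⟩
    refine ⟨fun b => if zc b ∈ s then w (zc b) else 0, ?_, ?_⟩
    · intro b
      dsimp only
      split_ifs with h
      · exact hw _ h
      · exact le_rfl
    · have h1 : s ⊆ A.image zc := by
        intro y hy
        obtain ⟨b, hb, rfl⟩ := hs hy
        exact Finset.mem_image_of_mem _ hb
      have h2 : ∑ b ∈ A, (if zc b ∈ s then w (zc b) else 0) • zc b
          = ∑ y ∈ A.image zc, (if y ∈ s then w y else 0) • y := by
        rw [Finset.sum_image (fun _ _ _ _ h => zc_inj h)]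
      rw [h2, ← Finset.sum_subset h1]
      · apply Finset.sum_congr rfl
        intro y hy
        simp [hy]
      · intro y _ hy
        simp [hy]
  · rintro ⟨w, hw, rfl⟩
    refine ⟨A.image zc, fun y => w (Function.invFun zc y), ?_, fun _ _ => hw _, ?_⟩
    · intro y hy
      simpa using hy
    · rw [Finset.sum_image (fun _ _ _ _ h => zc_inj h)]
      apply Finset.sum_congr rfl
      intro b _
      simp only [Function.leftInverse_invFun zc_inj b]

theorem inC.add {m : ℕ} {A : Finset (Fin m → ℤ)} {x y : Fin m → ℝ} (hx : inC A x)
    (hy : inC A y) : inC A (x + y) := by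
  obtain ⟨w, hw, rfl⟩ := hx
  obtain ⟨u, hu, rfl⟩ := hy
  refine ⟨fun b => w b + u b, fun b => add_nonneg (hw b) (hu b), ?_⟩
  rw [← Finset.sum_add_distrib]
  exact Finset.sum_congr rfl fun b _ => (add_smul _ _ _).symm

theorem inC.smul {m : ℕ} {A : Finset (Fin m → ℤ)} {x : Fin m → ℝ} (hx : inC A x)
    {t : ℝ} (ht : 0 ≤ t) : inC A (t • x) := by
  obtain ⟨w, hw, rfl⟩ := hx
  refine ⟨fun b => t * w b, fun b => mul_nonneg ht (hw b), ?_⟩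
  rw [Finset.smul_sum]
  exact Finset.sum_congr rfl fun b _ => (mul_smul _ _ _).symm

theorem inC.zero {m : ℕ} (A : Finset (Fin m → ℤ)) : inC A 0 :=
  ⟨fun _ => 0, fun _ => le_rfl, by simp⟩

theorem inC.mem {m : ℕ} {A : Finset (Fin m → ℤ)} {b : Fin m → ℤ} (hb : b ∈ A) :
    inC A (zc b) := by
  classical
  refine ⟨fun c => if c = b then 1 else 0, fun c => by positivity, ?_⟩
  simp [hb]

/-- if a nonnegative combination `y` has `-y` in the cone, so does each `-b`. -/
theorem inC.neg_of_pos {m : ℕ} {A : Finset (Fin m → ℤ)} {w : (Fin m → ℤ) → ℝ}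
    (hw : ∀ b, 0 ≤ w b) (hy : inC A (-∑ b ∈ A, w b • zc b)) {b : Fin m → ℤ} (hb : b ∈ A)
    (hpos : 0 < w b) : inC A (-zc b) := by
  classical
  have h1 : inC A (∑ c ∈ A.erase b, w c • zc c) := by
    refine ⟨fun c => if c = b then 0 else w c, fun c => ?_, ?_⟩
    · dsimp only
      split_ifs
      · exact le_rfl
      · exact hw c
    · rw [← Finset.add_sum_erase A _ hb]
      simp only [if_true, zero_smul, zero_add]
      refine Finset.sum_congr rfl fun c hc => ?_
      rw [if_neg (Finset.ne_of_mem_erase hc)]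
  have h2 := (hy.add h1).smul (inv_nonneg.2 hpos.le)
  rw [← Finset.add_sum_erase A _ hb] at h2
  have h3 : (w b)⁻¹ • (-(w b • zc b + ∑ c ∈ A.erase b, w c • zc c)
      + ∑ c ∈ A.erase b, w c • zc c) = -zc b := by
    rw [neg_add, neg_add_cancel_right, smul_neg, smul_smul, inv_mul_cancel₀ hpos.ne', one_smul]
  rwa [h3] at h2

/-- integer vectors bounded by the fractional-part bound of `A`. -/
def Rbox {m : ℕ} (A : Finset (Fin m → ℤ)) : Set (Fin m → ℤ) :=
  Set.Icc (fun i => -∑ b ∈ A, |b i|) (fun i => ∑ b ∈ A, |b i|)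

theorem Rbox_finite {m : ℕ} (A : Finset (Fin m → ℤ)) : (Rbox A).Finite := Set.finite_Icc _ _

theorem floor_mem_Rbox {m : ℕ} (A : Finset (Fin m → ℤ)) (x : Fin m → ℤ)
    (w : (Fin m → ℤ) → ℝ) (h : zc x = ∑ b ∈ A, w b • zc b) :
    x - ∑ b ∈ A, ⌊w b⌋ • b ∈ Rbox A := by
  have key : ∀ i, |(x - ∑ b ∈ A, ⌊w b⌋ • b) i| ≤ ∑ b ∈ A, |b i| := by
    intro i
    have hi := congrFun h i
    simp only [zc, Finset.sum_apply, Pi.smul_apply, smul_eq_mul] at hi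
    have h2 : (((x - ∑ b ∈ A, ⌊w b⌋ • b) i : ℤ) : ℝ) = ∑ b ∈ A, Int.fract (w b) * (b i : ℝ) := by
      simp only [Pi.sub_apply, Finset.sum_apply, Pi.smul_apply, smul_eq_mul]
      push_cast
      rw [hi, ← Finset.sum_sub_distrib]
      refine Finset.sum_congr rfl fun b _ => ?_
      rw [Int.fract]; ring
    have h3 : |(((x - ∑ b ∈ A, ⌊w b⌋ • b) i : ℤ) : ℝ)| ≤ ∑ b ∈ A, |(b i : ℝ)| := by
      rw [h2]
      refine (Finset.abs_sum_le_sum_abs _ _).trans (Finset.sum_le_sum fun b _ => ?_)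
      rw [abs_mul, abs_of_nonneg (Int.fract_nonneg _)]
      exact mul_le_of_le_one_left (abs_nonneg _) (Int.fract_lt_one _).le
    exact_mod_cast h3
  exact ⟨fun i => (abs_le.1 (key i)).1, fun i => (abs_le.1 (key i)).2⟩

theorem SC_mk {m : ℕ} {S : Set (Fin m → ℤ)} {A : Finset (Fin m → ℤ)} {x : Fin m → ℤ} :
    x ∈ SC S A ↔ x ∈ S ∧ inC A (zc x) := by
  rw [← mem_cone_iff]; rfl

theorem nsmul_mem' {m : ℕ} {S : Set (Fin m → ℤ)} (h0S : (0 : Fin m → ℤ) ∈ S)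
    (hSadd : ∀ x ∈ S, ∀ y ∈ S, x + y ∈ S) {x : Fin m → ℤ} (hx : x ∈ S) (n : ℕ) :
    n • x ∈ S := by
  induction n with
  | zero => simpa using h0S
  | succ n ih => rw [succ_nsmul]; exact hSadd _ ih _ hx

theorem sum_mem' {m : ℕ} {S : Set (Fin m → ℤ)} (h0S : (0 : Fin m → ℤ) ∈ S)
    (hSadd : ∀ x ∈ S, ∀ y ∈ S, x + y ∈ S) {ι : Type*} (s : Finset ι) (f : ι → Fin m → ℤ)
    (hf : ∀ i ∈ s, f i ∈ S) : ∑ i ∈ s, f i ∈ S :=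
  Finset.sum_induction f (· ∈ S) (fun x y hx hy => hSadd x hx y hy) h0S hf

theorem neg_mem_SC {m : ℕ} (S : Set (Fin m → ℤ)) (h0S : (0 : Fin m → ℤ) ∈ S)
    (hSadd : ∀ x ∈ S, ∀ y ∈ S, x + y ∈ S)
    (A : Finset (Fin m → ℤ)) (hAS : (A : Set (Fin m → ℤ)) ⊆ S)
    (b : Fin m → ℤ) (hb : b ∈ A) (h : inC A (-zc b)) : -b ∈ SC S A := by
  refine SC_mk.2 ⟨?_, by rwa [zc_neg]⟩
  obtain ⟨w, hw, hbw⟩ := h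
  let f : ℕ → (Fin m → ℤ) := fun k => -(k • b) - ∑ c ∈ A, ⌊(k : ℝ) * w c⌋ • c
  have hf : ∀ k ∈ (Set.univ : Set ℕ), f k ∈ Rbox A := by
    intro k _
    apply floor_mem_Rbox A (-(k • b)) (fun c => (k : ℝ) * w c)
    have : zc (-(k • b)) = (k : ℝ) • (-zc b) := by
      funext i; simp [zc]
    rw [this, hbw, Finset.smul_sum]
    exact Finset.sum_congr rfl fun b _ => (mul_smul _ _ _).symm
  obtain ⟨k, -, l, -, hne, hkl⟩ :=
    Set.infinite_univ.exists_ne_map_eq_of_mapsTo hf (Rbox_finite A)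
  wlog hlt : k < l generalizing k l
  · exact this l k hne.symm hkl.symm (lt_of_le_of_ne (not_lt.1 hlt) hne.symm)
  have hmono : ∀ c, ⌊(k : ℝ) * w c⌋ ≤ ⌊(l : ℝ) * w c⌋ := fun c =>
    Int.floor_le_floor (mul_le_mul_of_nonneg_right (by exact_mod_cast hlt.le) (hw c))
  obtain ⟨d, rfl⟩ := Nat.exists_eq_add_of_lt hlt
  have hsum : ∑ c ∈ A, (⌊((k + d + 1 : ℕ) : ℝ) * w c⌋ - ⌊(k : ℝ) * w c⌋).toNat • c ∈ S :=
    sum_mem' h0S hSadd _ _ fun c hc => nsmul_mem' h0S hSadd (hAS hc) _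
  have heq : ∑ c ∈ A, (⌊((k + d + 1 : ℕ) : ℝ) * w c⌋ - ⌊(k : ℝ) * w c⌋).toNat • c
      = -((d + 1) • b) := by
    have e1 : ∑ c ∈ A, (⌊((k + d + 1 : ℕ) : ℝ) * w c⌋ - ⌊(k : ℝ) * w c⌋).toNat • c
        = ∑ c ∈ A, ⌊((k + d + 1 : ℕ) : ℝ) * w c⌋ • c - ∑ c ∈ A, ⌊(k : ℝ) * w c⌋ • c := by
      rw [← Finset.sum_sub_distrib]
      refine Finset.sum_congr rfl fun c _ => ?_
      rw [← sub_smul, ← natCast_zsmul, Int.toNat_of_nonneg (sub_nonneg.2 (hmono c))]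
    rw [e1]
    simp only [f] at hkl
    have : ((k + d + 1) • b) = k • b + (d + 1) • b := by rw [add_assoc, add_smul]
    rw [this] at hkl
    have h3 := sub_eq_zero.2 hkl
    rw [← sub_eq_zero, ← h3]
    abel
  rw [heq] at hsum
  have h4 := hSadd _ hsum _ (nsmul_mem' h0S hSadd (hAS hb) d)
  have : -((d + 1) • b) + d • b = -b := by rw [succ_nsmul]; abel
  rwa [this] at h4

theorem conic_step {ι V : Type*} [AddCommGroup V] [Module ℝ V] [DecidableEq ι] (v : ι → V)
    (s : Finset ι) (a : ι) (ha : a ∉ s)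
    (hpt : ∀ ν : ι → ℝ, (∀ b, 0 ≤ ν b) → ∑ b ∈ insert a s, ν b • v b = 0 →
      ∀ b ∈ insert a s, ν b = 0)
    (hdep : ¬ LinearIndepOn ℝ v ((insert a s : Finset ι) : Set ι))
    (w : ι → ℝ) (hw : ∀ b, 0 ≤ w b) :
    ∃ b ∈ s, ∃ w' : ι → ℝ, (∀ b, 0 ≤ w' b) ∧
      ∑ c ∈ insert a s, w c • v c = ∑ c ∈ insert a (s.erase b), w' c • v c := by
  obtain ⟨μ, hμ, hμa, b₀, hb₀, hne⟩ : ∃ μ : ι → ℝ, ∑ i ∈ insert a s, μ i • v i = 0 ∧ μ a ≤ 0 ∧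
      ∃ b ∈ insert a s, μ b ≠ 0 := by
    obtain ⟨μ, hμ, b, hb, hne⟩ := not_linearIndepOn_finset_iff.1 hdep
    rcases le_total (μ a) 0 with h | h
    · exact ⟨μ, hμ, h, b, hb, hne⟩
    · refine ⟨fun i => -μ i, ?_, by simpa using h, b, hb, neg_ne_zero.2 hne⟩
      simp only [neg_smul, Finset.sum_neg_distrib, hμ, neg_zero]
  have hex : ∃ b ∈ s, 0 < μ b := by
    by_contra hcon
    push Not at hcon
    have hle : ∀ b ∈ insert a s, μ b ≤ 0 := by
      intro b hb
      rcases Finset.mem_insert.1 hb with rfl | hb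
      · exact hμa
      · exact hcon b hb
    have := hpt (fun b => |μ b|) (fun b => abs_nonneg _) (by
      have : ∑ b ∈ insert a s, |μ b| • v b = -∑ b ∈ insert a s, μ b • v b := by
        rw [← Finset.sum_neg_distrib]
        refine Finset.sum_congr rfl fun b hb => ?_
        rw [abs_of_nonpos (hle b hb), neg_smul]
      rw [this, hμ, neg_zero]) b₀ hb₀
    exact hne (abs_eq_zero.1 this)
  obtain ⟨b, hbm, hbmin⟩ := Finset.exists_min_image (s.filter fun b => 0 < μ b)
    (fun b => w b / μ b) (by
      obtain ⟨b, hb, h⟩ := hex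
      exact ⟨b, Finset.mem_filter.2 ⟨hb, h⟩⟩)
  obtain ⟨hb, hbpos⟩ := Finset.mem_filter.1 hbm
  set t := w b / μ b with ht
  have ht0 : 0 ≤ t := div_nonneg (hw b) hbpos.le
  have hnn : ∀ c ∈ insert a s, 0 ≤ w c - t * μ c := by
    intro c hc
    rcases le_or_gt (μ c) 0 with h | h
    · have := mul_nonpos_of_nonneg_of_nonpos ht0 h
      linarith [hw c]
    · have hcs : c ∈ s := by
        rcases Finset.mem_insert.1 hc with rfl | hc
        · exact absurd hμa (not_le.2 h)
        · exact hc
      have := hbmin c (Finset.mem_filter.2 ⟨hcs, h⟩)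
      rw [le_div_iff₀ h] at this
      linarith
  refine ⟨b, hb, fun c => |w c - t * μ c|, fun c => abs_nonneg _, ?_⟩
  have hab : a ≠ b := fun h => ha (h ▸ hb)
  have e1 : ∑ c ∈ insert a s, w c • v c = ∑ c ∈ insert a s, |w c - t * μ c| • v c := by
    have : ∑ c ∈ insert a s, |w c - t * μ c| • v c
        = ∑ c ∈ insert a s, w c • v c - t • ∑ c ∈ insert a s, μ c • v c := by
      rw [Finset.smul_sum, ← Finset.sum_sub_distrib]
      refine Finset.sum_congr rfl fun c hc => ?_
      rw [abs_of_nonneg (hnn c hc), sub_smul, mul_smul]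
    rw [this, hμ, smul_zero, sub_zero]
  rw [e1]
  symm
  apply Finset.sum_subset
  · exact Finset.insert_subset_insert _ (Finset.erase_subset _ _)
  · intro c hc hc'
    have : c = b := by
      by_contra hcb
      apply hc'
      rcases Finset.mem_insert.1 hc with rfl | hc
      · exact Finset.mem_insert_self _ _
      · exact Finset.mem_insert_of_mem (Finset.mem_erase.2 ⟨hcb, hc⟩)
    subst this
    have : w c - t * μ c = 0 := by
      rw [ht]; field_simp; ring
    simp only [this, abs_zero, zero_smul]

theorem conic {ι V : Type*} [AddCommGroup V] [Module ℝ V] [DecidableEq ι] (v : ι → V)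
    (a : ι) (n : ℕ) : ∀ (s : Finset ι), s.card = n → a ∉ s →
    (∀ ν : ι → ℝ, (∀ b, 0 ≤ ν b) → ∑ b ∈ insert a s, ν b • v b = 0 →
      ∀ b ∈ insert a s, ν b = 0) →
    ∀ (w : ι → ℝ), (∀ b, 0 ≤ w b) →
    ∃ s' ⊆ s, LinearIndepOn ℝ v ((insert a s' : Finset ι) : Set ι) ∧
      ∃ w' : ι → ℝ, (∀ b, 0 ≤ w' b) ∧
      ∑ c ∈ insert a s, w c • v c = ∑ c ∈ insert a s', w' c • v c := by
  induction n with
  | zero =>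
    intro s hs ha hpt w hw
    by_cases hdep : LinearIndepOn ℝ v ((insert a s : Finset ι) : Set ι)
    · exact ⟨s, subset_rfl, hdep, w, hw, rfl⟩
    · obtain ⟨b, hb, -⟩ := conic_step v s a ha hpt hdep w hw
      rw [Finset.card_eq_zero.1 hs] at hb
      simp at hb
  | succ n ih =>
    intro s hs ha hpt w hw
    by_cases hdep : LinearIndepOn ℝ v ((insert a s : Finset ι) : Set ι)
    · exact ⟨s, subset_rfl, hdep, w, hw, rfl⟩
    · obtain ⟨b, hb, w', hw', he⟩ := conic_step v s a ha hpt hdep w hw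
      have hsub : insert a (s.erase b) ⊆ insert a s :=
        Finset.insert_subset_insert _ (Finset.erase_subset _ _)
      obtain ⟨s', hs', hli, w'', hw'', he'⟩ := ih (s.erase b)
        (by rw [Finset.card_erase_of_mem hb, hs]; rfl)
        (fun h => ha (Finset.mem_of_mem_erase h)) (by
          intro ν hν h0 c hc
          have h1 := hpt (fun c => if c ∈ insert a (s.erase b) then ν c else 0) (by
            intro c
            split_ifs
            · exact hν c
            · exact le_rfl) (by
            rw [← h0, ← Finset.sum_subset hsub]
            · exact Finset.sum_congr rfl fun c hc => by rw [if_pos hc]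
            · intro c _ hc
              rw [if_neg hc, zero_smul]) c (hsub hc)
          simpa only [if_pos hc] using h1) w' hw'
      exact ⟨s', hs'.trans (Finset.erase_subset _ _), hli, w'', hw'', he.trans he'⟩

theorem dickson {ι : Type*} [Finite ι] (N : Set (ι → ℕ)) :
    ∃ F : Set (ι → ℕ), F.Finite ∧ F ⊆ N ∧ ∀ n ∈ N, ∃ f ∈ F, f ≤ n := by
  refine ⟨{x | Minimal (· ∈ N) x}, ?_, fun x hx => hx.1, fun n hn => ?_⟩
  · exact WellQuasiOrderedLE.finite_of_isAntichain (setOfPred_minimal_antichain _)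
  · obtain ⟨f, hf, hm⟩ := exists_minimal_le_of_wellFoundedLT (· ∈ N) n hn
    exact ⟨f, hm, hf⟩

theorem L0_inC {m : ℕ} (A : Finset (Fin m → ℤ)) {y : Fin m → ℝ} (hy : y ∈ L0 A) :
    inC A y ∧ inC A (-y) := by
  unfold L0 at hy
  induction hy using Submodule.span_induction with
  | mem x hx =>
    exact ⟨(mem_cone_iff A x).1 hx.1, (mem_cone_iff A (-x)).1 hx.2⟩
  | zero => simpa using inC.zero A
  | add x y _ _ hx hy =>
    refine ⟨hx.1.add hy.1, ?_⟩
    rw [neg_add]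
    exact hx.2.add hy.2
  | smul t x _ hx =>
    rcases le_total 0 t with ht | ht
    · refine ⟨hx.1.smul ht, ?_⟩
      rw [← smul_neg]
      exact hx.2.smul ht
    · have ht' : 0 ≤ -t := by linarith
      refine ⟨?_, ?_⟩
      · have := hx.2.smul ht'
        rwa [neg_smul_neg] at this
      · have := hx.1.smul ht'
        rwa [neg_smul] at this

theorem mem_L0 {m : ℕ} (A : Finset (Fin m → ℤ)) {y : Fin m → ℝ} (h1 : inC A y)
    (h2 : inC A (-y)) : y ∈ L0 A :=
  Submodule.subset_span ⟨(mem_cone_iff A y).2 h1, (mem_cone_iff A (-y)).2 h2⟩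

theorem A0_mem_L0 {m : ℕ} {S : Set (Fin m → ℤ)} {A : Finset (Fin m → ℤ)} {b : Fin m → ℤ}
    (hb : b ∈ A0 S A) : zc b ∈ L0 A := by
  refine mem_L0 A (inC.mem hb.1) ?_
  rw [← zc_neg]
  exact (SC_mk.1 hb.2).2

theorem decomp {m : ℕ} (S : Set (Fin m → ℤ)) (h0S : (0 : Fin m → ℤ) ∈ S)
    (hSadd : ∀ x ∈ S, ∀ y ∈ S, x + y ∈ S)
    (A : Finset (Fin m → ℤ)) (hAS : (A : Set (Fin m → ℤ)) ⊆ S)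
    (a : Fin m → ℤ) (ha : a ∈ (A : Set (Fin m → ℤ)) \ A0 S A)
    (x : Fin m → ℝ) (hx : inC A x) :
    ∃ B : Finset (Fin m → ℤ), ((B : Set (Fin m → ℤ)) ⊆ (A : Set (Fin m → ℤ)) \ A0 S A ∧ a ∈ B ∧
            LinearIndependent ℝ
              (fun x : (B : Set (Fin m → ℤ)) => (L0 A).mkQ (zc x.1)) ∧
            Submodule.span ℝ ((fun x => (L0 A).mkQ (zc x)) '' (B : Set (Fin m → ℤ))) =
              Submodule.map (L0 A).mkQ (Lsp A)) ∧
      ∃ w : (Fin m → ℤ) → ℝ, (∀ b ∈ B, 0 ≤ w b) ∧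
        (∀ b ∈ A, b ∉ A0 S A → b ∉ B → w b = 0) ∧ x = ∑ b ∈ A, w b • zc b := by
  classical
  have hneg : ∀ b ∈ A, inC A (-zc b) → b ∈ A0 S A := fun b hb h =>
    ⟨hb, neg_mem_SC S h0S hSadd A hAS b hb h⟩
  set Z : Finset (Fin m → ℤ) := A.filter (· ∈ A0 S A) with hZ
  set U : Finset (Fin m → ℤ) := A.filter (· ∉ A0 S A) with hU
  set v : (Fin m → ℤ) → ((Fin m → ℝ) ⧸ L0 A) := fun b => (L0 A).mkQ (zc b) with hv
  have hv0 : ∀ b ∈ Z, v b = 0 := by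
    intro b hb
    simp only [hv, Submodule.mkQ_apply]
    exact (Submodule.Quotient.mk_eq_zero _).2 (A0_mem_L0 (Finset.mem_filter.1 hb).2)
  have hsplit : ∀ f : (Fin m → ℤ) → ℝ,
      (L0 A).mkQ (∑ b ∈ A, f b • zc b) = ∑ b ∈ U, f b • v b := by
    intro f
    rw [map_sum, ← Finset.sum_filter_add_sum_filter_not A (· ∈ A0 S A)]
    simp only [map_smul]
    rw [Finset.sum_eq_zero (s := Finset.filter (· ∈ A0 S A) A), zero_add]
    intro b hb
    have := hv0 b hb
    simp only [hv] at this
    rw [this, smul_zero]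
  have hpt : ∀ ν : (Fin m → ℤ) → ℝ, (∀ b, 0 ≤ ν b) → ∑ b ∈ U, ν b • v b = 0 →
      ∀ b ∈ U, ν b = 0 := by
    intro ν hν h0 b hb
    by_contra hne
    have hpos : 0 < ν b := lt_of_le_of_ne (hν b) (Ne.symm hne)
    rw [← hsplit] at h0
    have hmem : ∑ b ∈ A, ν b • zc b ∈ L0 A := by
      rw [Submodule.mkQ_apply] at h0
      exact (Submodule.Quotient.mk_eq_zero _).1 h0
    have h1 := inC.neg_of_pos hν (L0_inC A hmem).2 (Finset.mem_filter.1 hb).1 hpos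
    exact (Finset.mem_filter.1 hb).2 (hneg b (Finset.mem_filter.1 hb).1 h1)
  have haU : a ∈ U := Finset.mem_filter.2 ⟨ha.1, ha.2⟩
  have hins : insert a (U.erase a) = U := Finset.insert_erase haU
  obtain ⟨w, hw, hxw⟩ := hx
  obtain ⟨s', hs', hli, w', hw', he⟩ := conic v a _ (U.erase a) rfl (Finset.notMem_erase _ _)
    (by rw [hins]; exact hpt) w hw
  rw [hins, ← hsplit, ← hxw] at he
  have hsU : insert a s' ⊆ U := by
    rw [← hins]; exact Finset.insert_subset_insert _ hs'
  obtain ⟨Bs, hBU, hsB, hspan, hBli⟩ := exists_linearIndepOn_extension hli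
    (Finset.coe_subset.2 hsU)
  obtain ⟨B, rfl⟩ : ∃ B : Finset (Fin m → ℤ), (B : Set (Fin m → ℤ)) = Bs :=
    ⟨(U.finite_toSet.subset hBU).toFinset, by simp⟩
  have hsB' : insert a s' ⊆ B := Finset.coe_subset.1 hsB
  have hBU' : B ⊆ U := Finset.coe_subset.1 hBU
  have hdiff : x - ∑ c ∈ insert a s', w' c • zc c ∈ L0 A := by
    rw [← Submodule.Quotient.mk_eq_zero, ← Submodule.mkQ_apply, map_sub, he, map_sum]
    simp only [map_smul, hv, sub_self]
  have hL0 : L0 A ≤ Submodule.span ℝ (zc '' (Z : Set (Fin m → ℤ))) := by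
    intro y hy
    obtain ⟨h1, h2⟩ := L0_inC A hy
    obtain ⟨u, hu, rfl⟩ := h1
    refine Submodule.sum_mem _ fun b hb => ?_
    rcases (hu b).eq_or_lt with h | h
    · rw [← h, zero_smul]; exact Submodule.zero_mem _
    · exact Submodule.smul_mem _ _ (Submodule.subset_span ⟨b,
        Finset.mem_coe.2 (Finset.mem_filter.2 ⟨hb, hneg b hb (inC.neg_of_pos hu h2 hb h)⟩), rfl⟩)
  obtain ⟨c, hc⟩ : ∃ c : (Fin m → ℤ) → ℝ,
      ∑ b ∈ Z, c b • zc b = x - ∑ c ∈ insert a s', w' c • zc c := by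
    obtain ⟨c, hc⟩ := (Submodule.mem_span_image_finset_iff_exists_fun ℝ).1 (hL0 hdiff)
    refine ⟨fun b => if h : b ∈ Z then c ⟨b, h⟩ else 0, ?_⟩
    rw [← hc, ← Finset.sum_coe_sort Z]
    exact Finset.sum_congr rfl fun b _ => by simp only [dif_pos b.2]
  refine ⟨B, ⟨?_, hsB' (Finset.mem_insert_self _ _), hBli, ?_⟩,
    fun b => if b ∈ A0 S A then c b else if b ∈ insert a s' then w' b else 0, ?_, ?_, ?_⟩
  · intro b hb
    have := Finset.mem_filter.1 (hBU' hb)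
    exact ⟨this.1, this.2⟩
  · apply le_antisymm
    · rw [Submodule.span_le]
      rintro _ ⟨b, hb, rfl⟩
      exact Submodule.mem_map_of_mem (Submodule.subset_span
        ⟨b, (Finset.mem_filter.1 (hBU' hb)).1, rfl⟩)
    · rw [Lsp, Submodule.map_span, Submodule.span_le]
      rintro _ ⟨_, ⟨b, hb, rfl⟩, rfl⟩
      by_cases hbA : b ∈ A0 S A
      · have := hv0 b (Finset.mem_filter.2 ⟨hb, hbA⟩)
        simp only [hv] at this
        rw [this]
        exact Submodule.zero_mem _
      · exact hspan ⟨b, Finset.mem_coe.2 (Finset.mem_filter.2 ⟨hb, hbA⟩), rfl⟩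
  · intro b hb
    have := (Finset.mem_filter.1 (hBU' hb)).2
    dsimp only
    rw [if_neg this]
    split_ifs
    · exact hw' b
    · exact le_rfl
  · intro b _ hb0 hbB
    dsimp only
    rw [if_neg hb0, if_neg fun h => hbB (hsB' h)]
  · rw [← Finset.sum_filter_add_sum_filter_not A (· ∈ A0 S A)]
    have e1 : ∑ b ∈ A.filter (· ∈ A0 S A),
        (if b ∈ A0 S A then c b else if b ∈ insert a s' then w' b else 0) • zc b
        = ∑ b ∈ Z, c b • zc b :=
      Finset.sum_congr rfl fun b hb => by rw [if_pos (Finset.mem_filter.1 hb).2]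
    have e2 : ∑ b ∈ A.filter (· ∉ A0 S A),
        (if b ∈ A0 S A then c b else if b ∈ insert a s' then w' b else 0) • zc b
        = ∑ b ∈ insert a s', w' b • zc b := by
      rw [← Finset.sum_subset hsU]
      · refine Finset.sum_congr rfl fun b hb => ?_
        rw [if_neg (Finset.mem_filter.1 (hsU hb)).2, if_pos hb]
      · intro b hb hb'
        rw [if_neg (Finset.mem_filter.1 hb).2, if_neg hb', zero_smul]
    rw [e1, e2, hc, sub_add_cancel]

theorem SC_add {m : ℕ} {S : Set (Fin m → ℤ)} (hSadd : ∀ x ∈ S, ∀ y ∈ S, x + y ∈ S)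
    {A : Finset (Fin m → ℤ)} {x y : Fin m → ℤ} (hx : x ∈ SC S A) (hy : y ∈ SC S A) :
    x + y ∈ SC S A := by
  rw [SC_mk] at *
  refine ⟨hSadd _ hx.1 _ hy.1, ?_⟩
  rw [zc_add]
  exact hx.2.add hy.2

theorem SC_of_mem {m : ℕ} {S : Set (Fin m → ℤ)} {A : Finset (Fin m → ℤ)}
    (hAS : (A : Set (Fin m → ℤ)) ⊆ S) {b : Fin m → ℤ} (hb : b ∈ A) : b ∈ SC S A :=
  SC_mk.2 ⟨hAS hb, inC.mem hb⟩

theorem gp_SC {m : ℕ} {S : Set (Fin m → ℤ)} (h0S : (0 : Fin m → ℤ) ∈ S)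
    (hSadd : ∀ x ∈ S, ∀ y ∈ S, x + y ∈ S)
    {A : Finset (Fin m → ℤ)} (hAS : (A : Set (Fin m → ℤ)) ⊆ S) {g : Fin m → ℤ}
    (hg : g ∈ AddSubgroup.closure (A0 S A)) : g ∈ SC S A ∧ -g ∈ SC S A := by
  induction hg using AddSubgroup.closure_induction with
  | mem x hx => exact ⟨SC_of_mem hAS hx.1, hx.2⟩
  | zero =>
    have : (0 : Fin m → ℤ) ∈ SC S A := SC_mk.2 ⟨h0S, by rw [zc_zero]; exact inC.zero A⟩
    simpa using this
  | add x y _ _ hx hy =>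
    refine ⟨SC_add hSadd hx.1 hy.1, ?_⟩
    rw [neg_add]
    exact SC_add hSadd hx.2 hy.2
  | neg x _ hx => exact ⟨hx.2, by rw [neg_neg]; exact hx.1⟩

theorem sg_SC {m : ℕ} {S : Set (Fin m → ℤ)} (h0S : (0 : Fin m → ℤ) ∈ S)
    (hSadd : ∀ x ∈ S, ∀ y ∈ S, x + y ∈ S)
    {A : Finset (Fin m → ℤ)} (hAS : (A : Set (Fin m → ℤ)) ⊆ S) {B : Set (Fin m → ℤ)}
    (hB : B ⊆ A) {g : Fin m → ℤ}
    (hg : g ∈ AddSubmonoid.closure B) : g ∈ SC S A := by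
  induction hg using AddSubmonoid.closure_induction with
  | mem x hx => exact SC_of_mem hAS (hB hx)
  | zero => exact SC_mk.2 ⟨h0S, by rw [zc_zero]; exact inC.zero A⟩
  | add x y _ _ hx hy => exact SC_add hSadd hx hy

/-- admissible multiplicity vectors -/
def NN {m : ℕ} (S : Set (Fin m → ℤ)) (A : Finset (Fin m → ℤ)) (B : Finset (Fin m → ℤ))
    (r : Fin m → ℤ) : Set (A → ℕ) :=
  {n | (∀ b : A, b.1 ∉ B → n b = 0) ∧ r + ∑ b : A, n b • b.1 ∈ S}

/-- structure theorem for `S_C` when `a ∈ A₁ = A \ A₀`: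
`S_C = T + gp(A₀) + ⋃_{a ∈ B ∈ 𝓑} sg(B)`, `𝓑` the sets `B ⊆ A₁` whose classes mod
`L₀` form a basis of `L/L₀`. -/
theorem stmt6 {m : ℕ} (S : Set (Fin m → ℤ)) (h0S : (0 : Fin m → ℤ) ∈ S)
    (hSadd : ∀ x ∈ S, ∀ y ∈ S, x + y ∈ S)
    (A : Finset (Fin m → ℤ)) (hAS : (A : Set (Fin m → ℤ)) ⊆ S)
    (a : Fin m → ℤ) (ha : a ∈ (A : Set (Fin m → ℤ)) \ A0 S A) :
    ∃ T : Finset (Fin m → ℤ),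
      (T : Set (Fin m → ℤ)) ⊆ SC S A ∧
      SC S A = (T : Set (Fin m → ℤ)) +
        (AddSubgroup.closure (A0 S A) : Set (Fin m → ℤ)) +
        ⋃ (B : Finset (Fin m → ℤ))
          (_ : (B : Set (Fin m → ℤ)) ⊆ (A : Set (Fin m → ℤ)) \ A0 S A ∧ a ∈ B ∧
            LinearIndependent ℝ
              (fun x : (B : Set (Fin m → ℤ)) => (L0 A).mkQ (zc x.1)) ∧
            Submodule.span ℝ ((fun x => (L0 A).mkQ (zc x)) '' (B : Set (Fin m → ℤ))) =
              Submodule.map (L0 A).mkQ (Lsp A)),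
          (AddSubmonoid.closure (B : Set (Fin m → ℤ)) : Set (Fin m → ℤ)) := by
  classical
  choose F hFfin hFsub hF using fun (B : Finset (Fin m → ℤ)) (r : Fin m → ℤ) => dickson (NN S A B r)
  let Tset : Set (Fin m → ℤ) := ⋃ B ∈ (A.powerset : Set (Finset (Fin m → ℤ))),
    ⋃ r ∈ {r | r ∈ Rbox A ∧ inC A (zc r)}, (fun n : A → ℕ => r + ∑ b : A, n b • b.1) '' F B r
  have hTfin : Tset.Finite := by
    refine Set.Finite.biUnion (Finset.finite_toSet _) fun B _ => ?_
    refine Set.Finite.biUnion ((Rbox_finite A).subset fun r hr => hr.1) fun r _ => ?_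
    exact (hFfin B r).image _
  have hTSC : Tset ⊆ SC S A := by
    intro y hy
    simp only [Tset, Set.mem_iUnion] at hy
    obtain ⟨B, _, r, hr, n, hn, rfl⟩ := hy
    refine SC_mk.2 ⟨(hFsub B r hn).2, ?_⟩
    rw [zc_add]
    refine hr.2.add ?_
    refine (SC_mk.1 (sg_SC h0S hSadd hAS (B := A) subset_rfl ?_)).2
    exact AddSubmonoid.sum_mem _ fun b _ =>
      AddSubmonoid.nsmul_mem _ (AddSubmonoid.subset_closure b.2) _
  refine ⟨hTfin.toFinset, by simpa using hTSC, ?_⟩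
  rw [Set.Finite.coe_toFinset]
  apply Set.Subset.antisymm
  · intro x hx
    obtain ⟨hxS, hxC⟩ := SC_mk.1 hx
    obtain ⟨B, hB, w, hwB, hw0, hxw⟩ := decomp S h0S hSadd A hAS a ha _ hxC
    set r := x - ∑ b ∈ A, ⌊w b⌋ • b with hr
    have hrR : r ∈ Rbox A := floor_mem_Rbox A x w hxw
    have hrC : inC A (zc r) := by
      refine ⟨fun b => Int.fract (w b), fun b => Int.fract_nonneg _, ?_⟩
      funext i
      have hi := congrFun hxw i
      simp only [zc, Finset.sum_apply, Pi.smul_apply, smul_eq_mul] at hi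
      simp only [zc, hr, Pi.sub_apply, Finset.sum_apply, Pi.smul_apply, smul_eq_mul]
      push_cast
      rw [hi, ← Finset.sum_sub_distrib]
      refine Finset.sum_congr rfl fun b _ => ?_
      rw [Int.fract]; ring
    let n : A → ℕ := fun b => if b.1 ∈ B then ⌊w b.1⌋.toNat else 0
    let g : Fin m → ℤ := ∑ b ∈ A.filter (· ∈ A0 S A), ⌊w b⌋ • b
    have hg : g ∈ AddSubgroup.closure (A0 S A) :=
      AddSubgroup.sum_mem _ fun b hb => AddSubgroup.zsmul_mem _
        (AddSubgroup.subset_closure (Finset.mem_filter.1 hb).2) _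
    have hsum : ∑ b ∈ A, ⌊w b⌋ • b = g + ∑ b : A, n b • b.1 := by
      have e1 : ∑ b : A, n b • b.1
          = ∑ b ∈ A, (if b ∈ B then ⌊w b⌋.toNat else 0) • b :=
        Finset.sum_coe_sort A (fun b => (if b ∈ B then ⌊w b⌋.toNat else 0) • b)
      have e2 : g = ∑ b ∈ A, if b ∈ A0 S A then ⌊w b⌋ • b else 0 := Finset.sum_filter _ _
      rw [e1, e2, ← Finset.sum_add_distrib]
      refine Finset.sum_congr rfl fun b hb => ?_
      by_cases hbB : b ∈ B
      · rw [if_pos hbB, if_neg (hB.1 hbB).2, zero_add, ← natCast_zsmul,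
          Int.toNat_of_nonneg (Int.floor_nonneg.2 (hwB b hbB))]
      · by_cases hb0 : b ∈ A0 S A
        · rw [if_neg hbB, if_pos hb0, zero_smul, add_zero]
        · rw [if_neg hbB, if_neg hb0, hw0 b hb hb0 hbB]
          simp
    have hxe : x = r + (g + ∑ b : A, n b • b.1) := by
      rw [← hsum, hr]; abel
    have hnN : n ∈ NN S A B r := by
      refine ⟨fun b hb => if_neg hb, ?_⟩
      have := hSadd _ hxS _ (SC_mk.1 (gp_SC h0S hSadd hAS hg).2).1
      rw [hxe] at this
      have e : r + (g + ∑ b : A, n b • b.1) + -g = r + ∑ b : A, n b • b.1 := by abel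
      rwa [e] at this
    obtain ⟨f, hf, hfn⟩ := hF B r n hnN
    have hns : ∑ b : A, n b • b.1 = ∑ b : A, f b • b.1 + ∑ b : A, (n b - f b) • b.1 := by
      rw [← Finset.sum_add_distrib]
      refine Finset.sum_congr rfl fun b _ => ?_
      rw [← add_smul, Nat.add_sub_cancel' (hfn b)]
    refine Set.mem_add.2 ⟨r + ∑ b : A, f b • b.1 + g, Set.mem_add.2 ⟨_, ?_, g, hg, rfl⟩,
      ∑ b : A, (n b - f b) • b.1, ?_, ?_⟩
    · simp only [Tset, Set.mem_iUnion]
      refine ⟨B, ?_, r, ⟨hrR, hrC⟩, f, hf, rfl⟩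
      simp only [Finset.mem_coe, Finset.mem_powerset]
      exact fun b hb => (hB.1 hb).1
    · refine Set.mem_iUnion₂.2 ⟨B, hB, ?_⟩
      refine AddSubmonoid.sum_mem _ fun b _ => ?_
      by_cases hbB : b.1 ∈ B
      · exact AddSubmonoid.nsmul_mem _ (AddSubmonoid.subset_closure hbB) _
      · rw [hnN.1 b hbB, Nat.zero_sub, zero_smul]
        exact AddSubmonoid.zero_mem _
    · rw [hxe, hns]; abel
  · intro x hx
    obtain ⟨y, hy, z, hz, rfl⟩ := Set.mem_add.1 hx
    obtain ⟨t, ht, g, hg, rfl⟩ := Set.mem_add.1 hy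
    obtain ⟨B, hB, hzB⟩ := Set.mem_iUnion₂.1 hz
    exact SC_add hSadd (SC_add hSadd (hTSC ht) (gp_SC h0S hSadd hAS hg).1)
      (sg_SC h0S hSadd hAS (fun b hb => (hB.1 hb).1) hzB)
end
end

section
/- Let S ⊆ ℤ^m be a vector semigroup, O = rint(cone(S)) its asymptotic cone, and q a ℤ-gauge on S. Then the restriction of q to O ∩ S extends in a unique way to a gauge on O, i.e., a function q̄ : O → [−∞, ∞) satisfying q̄(x+y) ≤ q̄(x) + q̄(y) and q̄(sx) = s·q̄(x) for all x, y ∈ O and real s > 0. -/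
open Set Filter Topology MeasureTheory ProbabilityTheory Pointwise

noncomputable section

/-- The asymptotic cone `O = rint(cone(S))` of a vector semigroup. -/
def acone {m : ℕ} (S : Set (Fin m → ℤ)) : Set (Fin m → ℝ) :=
  intrinsicInterior ℝ (coneHull (zc '' S))

lemma ereal_scale {s : ℝ} (hs : 0 < s) (e : EReal) (r : ℝ) :
    (s : EReal) * e ≤ ((s * r : ℝ) : EReal) ↔ e ≤ (r : EReal) := by
  induction e with
  | bot => simp [EReal.coe_mul_bot_of_pos hs]
  | top => simp [EReal.coe_mul_top_of_pos hs, -EReal.coe_mul]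
  | coe a =>
    rw [← EReal.coe_mul, EReal.coe_le_coe_iff, EReal.coe_le_coe_iff]
    exact mul_le_mul_iff_right₀ hs

lemma ereal_le_of {a b : EReal} (h : ∀ r : ℝ, b ≤ r → a ≤ r) : a ≤ b := by
  induction b with
  | bot =>
    rw [le_bot_iff, EReal.eq_bot_iff_forall_lt]
    intro y
    exact lt_of_le_of_lt (h (y - 1) bot_le) (by exact_mod_cast sub_one_lt y)
  | top => exact le_top
  | coe c => exact h c le_rfl

lemma ereal_scale_inj {s : ℝ} (hs : 0 < s) {a b : EReal}
    (h : (s : EReal) * a = (s : EReal) * b) : a = b := by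
  apply le_antisymm
  · exact ereal_le_of fun r hr => (ereal_scale hs a r).1 (h ▸ (ereal_scale hs b r).2 hr)
  · exact ereal_le_of fun r hr => (ereal_scale hs b r).1 (h ▸ (ereal_scale hs a r).2 hr)

lemma exists_psi {ι : Type} [Fintype ι] (u : ι → ℝ) (U : Set (ι → ℝ)) (hU : IsOpen U)
    (hu : u ∈ U) : ∃ ψ : ℝ →ₗ[ℚ] ℚ, (fun i => ((ψ (u i) : ℚ) : ℝ)) ∈ U := by
  classical
  let b := Module.Basis.ofVectorSpace ℚ ℝ
  let Φ : (Module.Basis.ofVectorSpaceIndex ℚ ℝ → ℝ) → (ι → ℝ) :=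
    fun e i => ∑ j ∈ (b.repr (u i)).support, ((b.repr (u i) j : ℚ) : ℝ) * e j
  have hΦ : Continuous Φ := by
    refine continuous_pi fun i => continuous_finsetSum _ fun j _ => ?_
    exact continuous_const.mul (continuous_apply j)
  have hb : Φ (fun j => b j) = u := by
    funext i
    have := b.linearCombination_repr (u i)
    rw [Finsupp.linearCombination_apply, Finsupp.sum] at this
    conv_rhs => rw [← this]
    simp only [Φ, Rat.smul_def]
  have hd : DenseRange (Pi.map (fun (_ : Module.Basis.ofVectorSpaceIndex ℚ ℝ) (x : ℚ) => (x : ℝ))) :=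
    DenseRange.piMap fun _ => Rat.denseRange_cast
  obtain ⟨e, he⟩ := hd.exists_mem_open (hU.preimage hΦ) ⟨fun j => b j, by
    rw [mem_preimage, hb]; exact hu⟩
  refine ⟨b.constr ℚ e, ?_⟩
  convert (mem_preimage.1 he) using 1
  funext i
  simp only [Φ, Module.Basis.constr_apply, Finsupp.sum, Pi.map_apply]
  push_cast
  simp

lemma common_denom {ι : Type} [Fintype ι] (a : ι → ℚ) (ha : ∀ i, 0 < a i) :
    ∃ (N : ℕ) (n : ι → ℕ), 0 < N ∧ (∀ i, 0 < n i) ∧ ∀ i, (n i : ℚ) = N * a i := by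
  classical
  refine ⟨∏ i, (a i).den, fun i => (a i).num.toNat * ∏ j ∈ Finset.univ.erase i, (a j).den,
    Finset.prod_pos fun i _ => (a i).den_pos, fun i => Nat.mul_pos ?_
      (Finset.prod_pos fun i _ => (a i).den_pos), fun i => ?_⟩
  · have := Rat.num_pos.2 (ha i)
    omega
  · rw [← Finset.mul_prod_erase Finset.univ _ (Finset.mem_univ i)]
    have h1 : (((a i).num.toNat : ℤ)) = (a i).num := Int.toNat_of_nonneg (Rat.num_pos.2 (ha i)).le
    have h2 : (((a i).num.toNat : ℕ) : ℚ) = (a i) * (a i).den := by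
      rw [Rat.mul_den_eq_num]; exact_mod_cast h1
    push_cast
    rw [h2]
    ring

/-- The convex cone generated by the epigraph of `q`. -/
def KK {m : ℕ} (S : Set (Fin m → ℤ)) (q : (Fin m → ℤ) → EReal) (x : Fin m → ℝ) (r : ℝ) : Prop :=
  ∃ (ι : Type) (_ : Fintype ι) (_ : Nonempty ι) (w : ι → ℝ) (s : ι → Fin m → ℤ) (ρ : ι → ℝ),
    (∀ i, 0 < w i) ∧ (∀ i, s i ∈ S) ∧ (∀ i, q (s i) ≤ (ρ i : EReal)) ∧
    x = ∑ i, w i • zc (s i) ∧ r = ∑ i, w i * ρ i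

lemma KK.add {m : ℕ} {S : Set (Fin m → ℤ)} {q : (Fin m → ℤ) → EReal} {x y : Fin m → ℝ} {r t : ℝ}
    (h : KK S q x r) (h' : KK S q y t) : KK S q (x + y) (r + t) := by
  obtain ⟨ι, _, _, w, s, ρ, h1, h2, h3, h4, h5⟩ := h
  obtain ⟨ι', _, _, w', s', ρ', h1', h2', h3', h4', h5'⟩ := h'
  refine ⟨ι ⊕ ι', inferInstance, inferInstance, Sum.elim w w', Sum.elim s s', Sum.elim ρ ρ',
    ?_, ?_, ?_, ?_, ?_⟩
  · rintro (i | i) <;> simp [h1, h1']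
  · rintro (i | i) <;> simp [h2, h2']
  · rintro (i | i) <;> simp [h3, h3']
  · simp [Fintype.sum_sum_type, h4, h4']
  · simp [Fintype.sum_sum_type, h5, h5']

lemma KK.smul {m : ℕ} {S : Set (Fin m → ℤ)} {q : (Fin m → ℤ) → EReal} {x : Fin m → ℝ} {r c : ℝ}
    (hc : 0 < c) (h : KK S q x r) : KK S q (c • x) (c * r) := by
  obtain ⟨ι, _, _, w, s, ρ, h1, h2, h3, h4, h5⟩ := h
  refine ⟨ι, inferInstance, inferInstance, fun i => c * w i, s, ρ,
    fun i => mul_pos hc (h1 i), h2, h3, ?_, ?_⟩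
  · simp [h4, Finset.smul_sum, mul_smul]
  · simp [h5, Finset.mul_sum, mul_assoc]

lemma int_sum {m : ℕ} {S : Set (Fin m → ℤ)}
    (hSadd : ∀ x ∈ S, ∀ y ∈ S, x + y ∈ S) {ι : Type} [Fintype ι] [Nonempty ι]
    (s : ι → Fin m → ℤ) (hs : ∀ i, s i ∈ S) (n : ι → ℕ) (hn : ∀ i, 0 < n i) :
    ∑ i, n i • s i ∈ S := by
  have hsm : ∀ x ∈ S, ∀ k : ℕ, (k + 1) • x ∈ S := by
    intro x hx k
    induction k with
    | zero => simpa using hx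
    | succ k ih => rw [succ_nsmul]; exact hSadd _ ih _ hx
  refine Finset.sum_induction_nonempty (fun i => n i • s i) (· ∈ S)
    (fun a b ha hb => hSadd a ha b hb) Finset.univ_nonempty ?_
  intro i _
  obtain ⟨k, hk⟩ := Nat.exists_eq_succ_of_ne_zero (hn i).ne'
  simp only [hk]
  exact hsm _ (hs i) k

lemma int_gauge {m : ℕ} {S : Set (Fin m → ℤ)}
    (hSadd : ∀ x ∈ S, ∀ y ∈ S, x + y ∈ S)
    {q : (Fin m → ℤ) → EReal}
    (hqsub : ∀ x ∈ S, ∀ y ∈ S, q (x + y) ≤ q x + q y)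
    (hqhom : ∀ x ∈ S, ∀ t : ℕ, 0 < t → q (t • x) = ((t : ℝ) : EReal) * q x)
    {ι : Type} [Fintype ι] [Nonempty ι]
    (s : ι → Fin m → ℤ) (hs : ∀ i, s i ∈ S) (n : ι → ℕ) (hn : ∀ i, 0 < n i)
    (ρ : ι → ℝ) (hρ : ∀ i, q (s i) ≤ (ρ i : EReal)) :
    q (∑ i, n i • s i) ≤ ((∑ i, n i * ρ i : ℝ) : EReal) := by
  have key : (fun z : (Fin m → ℤ) × ℝ => z.1 ∈ S ∧ q z.1 ≤ (z.2 : EReal))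
      (∑ i, (n i • s i, (n i : ℝ) * ρ i)) := by
    refine Finset.sum_induction_nonempty (fun i => ((n i • s i, (n i : ℝ) * ρ i) : (Fin m → ℤ) × ℝ))
      (fun z : (Fin m → ℤ) × ℝ => z.1 ∈ S ∧ q z.1 ≤ (z.2 : EReal)) ?_
      Finset.univ_nonempty ?_
    · rintro a b ⟨ha, ha'⟩ ⟨hb, hb'⟩
      refine ⟨hSadd _ ha _ hb, (hqsub _ ha _ hb).trans ?_⟩
      rw [Prod.snd_add, EReal.coe_add]
      exact add_le_add ha' hb'
    · intro i _
      have := int_sum hSadd (ι := Unit) (fun _ => s i) (fun _ => hs i) (fun _ => n i) (fun _ => hn i)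
      refine ⟨by simpa using this, ?_⟩
      simp only
      rw [hqhom _ (hs i) _ (hn i)]
      exact (ereal_scale (by exact_mod_cast hn i) _ _).2 (hρ i)
  simp only [Prod.fst_sum, Prod.snd_sum] at key
  exact key.2

lemma zc_sum {m : ℕ} {ι : Type} [Fintype ι] (s : ι → Fin m → ℤ) (n : ι → ℕ) :
    zc (∑ i, n i • s i) = ∑ i, (n i : ℝ) • zc (s i) := by
  funext j
  simp [zc, Finset.sum_apply]

lemma KK_int {m : ℕ} {S : Set (Fin m → ℤ)}
    (hSadd : ∀ x ∈ S, ∀ y ∈ S, x + y ∈ S)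
    {q : (Fin m → ℤ) → EReal}
    (hqsub : ∀ x ∈ S, ∀ y ∈ S, q (x + y) ≤ q x + q y)
    (hqhom : ∀ x ∈ S, ∀ t : ℕ, 0 < t → q (t • x) = ((t : ℝ) : EReal) * q x)
    {x : Fin m → ℤ} (hx : x ∈ S) {r : ℝ} (h : KK S q (zc x) r) : q x ≤ (r : EReal) := by
  obtain ⟨ι, _, _, w, s, ρ, h1, h2, h3, h4, h5⟩ := h
  refine EReal.le_of_forall_lt_iff_le.1 fun r' hr' => ?_
  have hr' : r < r' := by exact_mod_cast hr'
  let U : Set (Option ι → ℝ) :=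
    {v | (∀ i, 0 < v i) ∧ ∑ i, v (some i) * ρ i < r' * v none}
  have hU : IsOpen U := by
    apply IsOpen.and
    · simp only [Set.ofPred_forall]
      exact isOpen_iInter_of_finite fun i => isOpen_lt continuous_const (continuous_apply i)
    · exact isOpen_lt (continuous_finsetSum _ fun i _ => (continuous_apply _).mul continuous_const)
        (continuous_const.mul (continuous_apply _))
  obtain ⟨ψ, hψ⟩ := exists_psi (fun i : Option ι => i.elim 1 w) U hU ⟨by
    rintro (_ | i) <;> simp [h1], by simpa [← h5] using hr'⟩
  obtain ⟨hpos, hlt⟩ := hψ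
  obtain ⟨N, n, hN, hn, hna⟩ := common_denom (fun i : Option ι => ψ (i.elim 1 w))
    (fun i => Rat.cast_pos.1 (hpos i))
  have hsum : n none • x = ∑ i, n (some i) • s i := by
    funext j
    have e := congrFun h4 j
    simp only [zc, Finset.sum_apply, Pi.smul_apply, smul_eq_mul] at e
    have e2 : (x j) • (1 : ℝ) = ∑ i, (s i j) • w i := by
      simp [e, mul_comm]
    have e3 := congrArg ψ e2
    rw [map_zsmul, map_sum] at e3
    have e4 : ∀ i, ψ (s i j • w i) = (s i j : ℚ) * ψ (w i) := fun i => by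
      rw [map_zsmul, zsmul_eq_mul]
    simp only [e4] at e3
    rw [zsmul_eq_mul] at e3
    have : ((n none • x) j : ℚ) = ((∑ i, n (some i) • s i) j : ℤ) := by
      rw [Finset.sum_apply]
      simp only [Pi.smul_apply]
      simp only [nsmul_eq_mul, Int.cast_sum, Int.cast_mul, Int.cast_natCast]
      simp only [hna, Option.elim]
      rw [mul_assoc, mul_comm (ψ 1), e3, Finset.mul_sum]
      exact Finset.sum_congr rfl fun i _ => by ring
    exact_mod_cast this
  have hq := int_gauge hSadd hqsub hqhom s h2 (fun i => n (some i)) (fun i => hn _) ρ h3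
  rw [← hsum, hqhom _ hx _ (hn none)] at hq
  have hnp : (0 : ℝ) < (n none : ℝ) := by exact_mod_cast hn none
  refine (ereal_scale hnp _ _).1 (hq.trans ?_)
  have hnr : ∀ i, (n i : ℝ) = N * ((ψ (i.elim 1 w) : ℚ) : ℝ) := fun i => by exact_mod_cast hna i
  rw [EReal.coe_le_coe_iff]
  simp only [hnr]
  have hNp : (0 : ℝ) < N := by exact_mod_cast hN
  have := mul_lt_mul_of_pos_left hlt hNp
  rw [Finset.mul_sum] at this
  simp only [mul_assoc] at this ⊢
  rw [mul_comm r'] at this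
  exact this.le

lemma cone_zero {m : ℕ} (A : Set (Fin m → ℝ)) : (0 : Fin m → ℝ) ∈ coneHull A :=
  ⟨∅, 0, by simp, by simp, by simp⟩

lemma cone_smul {m : ℕ} {A : Set (Fin m → ℝ)} {x : Fin m → ℝ} (hx : x ∈ coneHull A) {c : ℝ}
    (hc : 0 ≤ c) : c • x ∈ coneHull A := by
  obtain ⟨s, w, h1, h2, h3⟩ := hx
  exact ⟨s, fun a => c * w a, h1, fun a ha => mul_nonneg hc (h2 a ha), by
    simp [h3, Finset.smul_sum, mul_smul]⟩

lemma cone_add {m : ℕ} {A : Set (Fin m → ℝ)} {x y : Fin m → ℝ} (hx : x ∈ coneHull A)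
    (hy : y ∈ coneHull A) : x + y ∈ coneHull A := by
  classical
  obtain ⟨s, w, h1, h2, h3⟩ := hx
  obtain ⟨s', w', h1', h2', h3'⟩ := hy
  refine ⟨s ∪ s', fun a => (if a ∈ s then w a else 0) + (if a ∈ s' then w' a else 0), ?_, ?_, ?_⟩
  · rw [Finset.coe_union]; exact union_subset h1 h1'
  · intro a _
    apply add_nonneg <;> split_ifs with h
    exacts [h2 a h, le_rfl, h2' a h, le_rfl]
  · simp only [add_smul, Finset.sum_add_distrib, ite_smul, zero_smul, Finset.sum_ite_mem, h3, h3']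
    simp

lemma cone_of_mem {m : ℕ} {A : Set (Fin m → ℝ)} {x : Fin m → ℝ} (hx : x ∈ A) : x ∈ coneHull A :=
  ⟨{x}, 1, by simpa using hx, by simp, by simp⟩

lemma cone_convex {m : ℕ} (A : Set (Fin m → ℝ)) : Convex ℝ (coneHull A) :=
  fun _ hx _ hy _ _ ha hb _ => cone_add (cone_smul hx ha) (cone_smul hy hb)

lemma mem_ii {m : ℕ} {C : Set (Fin m → ℝ)} {x : Fin m → ℝ} :
    x ∈ intrinsicInterior ℝ C ↔ x ∈ affineSpan ℝ C ∧
      ∃ ε > 0, ∀ y ∈ affineSpan ℝ C, dist y x < ε → y ∈ C := by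
  rw [mem_intrinsicInterior]
  constructor
  · rintro ⟨y, hy, rfl⟩
    obtain ⟨ε, hε, h⟩ := Metric.mem_nhds_iff.1 (mem_interior_iff_mem_nhds.1 hy)
    exact ⟨y.2, ε, hε, fun z hz hd => h (a := ⟨z, hz⟩) (Metric.mem_ball.2 hd)⟩
  · rintro ⟨hx, ε, hε, h⟩
    refine ⟨⟨x, hx⟩, mem_interior_iff_mem_nhds.2 (Metric.mem_nhds_iff.2 ⟨ε, hε, ?_⟩), rfl⟩
    intro z hz
    exact h z.1 z.2 hz

lemma aff_comb {m : ℕ} (A : Set (Fin m → ℝ)) {x y : Fin m → ℝ} (c d : ℝ)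
    (hx : x ∈ affineSpan ℝ (coneHull A)) (hy : y ∈ affineSpan ℝ (coneHull A)) :
    c • x + d • y ∈ affineSpan ℝ (coneHull A) := by
  have h0 := subset_affineSpan ℝ _ (cone_zero A)
  have h1 : d • y ∈ affineSpan ℝ (coneHull A) := by
    simpa using (affineSpan ℝ (coneHull A)).smul_vsub_vadd_mem d hy h0 h0
  simpa using (affineSpan ℝ (coneHull A)).smul_vsub_vadd_mem c hx h0 h1

lemma ii_add {m : ℕ} {A : Set (Fin m → ℝ)} {x c : Fin m → ℝ}
    (hx : x ∈ intrinsicInterior ℝ (coneHull A)) (hc : c ∈ coneHull A) :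
    x + c ∈ intrinsicInterior ℝ (coneHull A) := by
  rw [mem_ii] at hx ⊢
  obtain ⟨hx, ε, hε, h⟩ := hx
  have hc' := subset_affineSpan ℝ _ hc
  refine ⟨by simpa using aff_comb A 1 1 hx hc', ε, hε, fun y hy hd => ?_⟩
  have : y - c ∈ coneHull A := by
    apply h
    · simpa [sub_eq_add_neg] using aff_comb A 1 (-1) hy hc'
    · rw [dist_eq_norm] at hd ⊢
      convert hd using 2
      abel
  simpa using cone_add this hc

lemma ii_smul {m : ℕ} {A : Set (Fin m → ℝ)} {x : Fin m → ℝ}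
    (hx : x ∈ intrinsicInterior ℝ (coneHull A)) {c : ℝ} (hc : 0 < c) :
    c • x ∈ intrinsicInterior ℝ (coneHull A) := by
  rw [mem_ii] at hx ⊢
  obtain ⟨hx, ε, hε, h⟩ := hx
  refine ⟨by simpa using aff_comb A c 0 hx hx, c * ε, by positivity, fun y hy hd => ?_⟩
  have : c⁻¹ • y ∈ coneHull A := by
    apply h
    · simpa using aff_comb A c⁻¹ 0 hy hy
    · have e : y - c • x = c • (c⁻¹ • y - x) := by
        rw [smul_sub, smul_inv_smul₀ hc.ne']
      rw [dist_eq_norm] at hd ⊢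
      rw [e, norm_smul, Real.norm_of_nonneg hc.le] at hd
      exact lt_of_mul_lt_mul_left hd hc.le
  simpa [smul_inv_smul₀ hc.ne'] using cone_smul this hc.le

lemma ii_sub {m : ℕ} {A : Set (Fin m → ℝ)} {x u : Fin m → ℝ}
    (hx : x ∈ intrinsicInterior ℝ (coneHull A)) (hu : u ∈ coneHull A) :
    ∃ δ : ℝ, 0 < δ ∧ x - δ • u ∈ coneHull A := by
  rw [mem_ii] at hx
  obtain ⟨hx, ε, hε, h⟩ := hx
  refine ⟨ε / (‖u‖ + 1), by positivity, h _ ?_ ?_⟩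
  · simpa [sub_eq_add_neg] using aff_comb A 1 (-(ε / (‖u‖ + 1))) hx (subset_affineSpan ℝ _ hu)
  · rw [dist_eq_norm, sub_sub_cancel_left, norm_neg, norm_smul, Real.norm_of_nonneg (by positivity),
      div_mul_eq_mul_div, div_lt_iff₀ (by positivity)]
    nlinarith [norm_nonneg u]

/-- indexed form of membership in the cone -/
lemma cone_rep {m : ℕ} {S : Set (Fin m → ℤ)} {x : Fin m → ℝ} (hx : x ∈ coneHull (zc '' S)) :
    ∃ (ι : Type) (_ : Fintype ι) (w : ι → ℝ) (s : ι → Fin m → ℤ),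
      (∀ i, 0 < w i) ∧ (∀ i, s i ∈ S) ∧ x = ∑ i, w i • zc (s i) := by
  obtain ⟨s, w, h1, h2, h3⟩ := hx
  classical
  let t := s.filter fun a => w a ≠ 0
  have ht : ∀ a ∈ t, a ∈ s ∧ w a ≠ 0 := fun a ha => Finset.mem_filter.1 ha
  choose f hf hf' using fun a : t => h1 (ht a.1 a.2).1
  let e := t.equivFin.symm
  refine ⟨Fin t.card, inferInstance, fun a => w (e a), fun a => f (e a),
    fun a => lt_of_le_of_ne (h2 _ (ht _ (e a).2).1) (ht _ (e a).2).2.symm, fun a => hf _, ?_⟩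
  simp only [hf', h3]
  rw [Equiv.sum_comp e (fun a : t => w a • (a : Fin m → ℝ)),
    Finset.sum_coe_sort t (fun a => w a • a), Finset.sum_filter_of_ne]
  intro a _ h h0
  exact h (by rw [h0, zero_smul])

lemma exists_u {m : ℕ} {S : Set (Fin m → ℤ)} (hSne : S.Nonempty)
    (hSadd : ∀ x ∈ S, ∀ y ∈ S, x + y ∈ S) : ∃ u ∈ S, zc u ∈ acone S := by
  obtain ⟨v, hv⟩ := Set.Nonempty.intrinsicInterior (cone_convex (zc '' S)) ⟨0, cone_zero _⟩
  obtain ⟨ι, _, w, s, hw, hs, e⟩ := cone_rep (intrinsicInterior_subset hv)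
  obtain ⟨s0, hs0⟩ := hSne
  choose n hn using fun i => exists_nat_gt (w i)
  have hmem := int_sum hSadd (ι := Option ι) (fun i => i.elim s0 s)
    (by rintro (_ | i) <;> simp [hs0, hs]) (fun i => i.elim 1 n)
    (by rintro (_ | i)
        · simp
        · have := (hw i).trans (hn i)
          simpa using (by exact_mod_cast this : 0 < n i))
  refine ⟨_, hmem, ?_⟩
  rw [zc_sum, Fintype.sum_option]
  have : (∑ i, ((n i : ℕ) : ℝ) • zc (s i)) = v + ∑ i, ((n i : ℝ) - w i) • zc (s i) := by
    rw [e, ← Finset.sum_add_distrib]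
    exact Finset.sum_congr rfl fun i _ => by rw [← add_smul]; congr 1; ring
  simp only [Option.elim, this]
  rw [add_left_comm]
  refine ii_add hv (cone_add (cone_smul (cone_of_mem (mem_image_of_mem zc hs0)) (by simp)) ?_)
  refine Finset.sum_induction _ (· ∈ coneHull (zc '' S)) (fun _ _ => cone_add) (cone_zero _) ?_
  intro i _
  exact cone_smul (cone_of_mem (mem_image_of_mem zc (hs i))) (sub_nonneg.2 (hn i).le)

lemma acone_rep {m : ℕ} {S : Set (Fin m → ℤ)} (hSne : S.Nonempty)
    (hSadd : ∀ x ∈ S, ∀ y ∈ S, x + y ∈ S) {x : Fin m → ℝ} (hx : x ∈ acone S) :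
    ∃ (ι : Type) (_ : Fintype ι) (_ : Nonempty ι) (w : ι → ℝ) (s : ι → Fin m → ℤ),
      (∀ i, 0 < w i) ∧ (∀ i, s i ∈ S) ∧ (∀ i, zc (s i) ∈ acone S) ∧
      x = ∑ i, w i • zc (s i) := by
  obtain ⟨u, hu, huO⟩ := exists_u hSne hSadd
  obtain ⟨δ, hδ, hm⟩ := ii_sub hx (cone_of_mem ⟨u, hu, rfl⟩ : zc u ∈ coneHull (zc '' S))
  obtain ⟨ι, _, w, s, hw, hs, e⟩ := cone_rep hm
  obtain ⟨N, hN⟩ := exists_nat_gt ((∑ i, w i) / δ)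
  have hW : 0 ≤ ∑ i, w i := Finset.sum_nonneg fun i _ => (hw i).le
  have hNp : (0 : ℝ) < N := lt_of_le_of_lt (by positivity) hN
  have hNn : 0 < N := by exact_mod_cast hNp
  have hNs : ∀ i, zc (N • s i + u) = (N : ℝ) • zc (s i) + zc u := by
    intro i; funext j; simp [zc]
  have hNS : ∀ i, N • s i + u ∈ S := by
    intro i
    have := int_sum hSadd (ι := Unit) (fun _ => s i) (fun _ => hs i) (fun _ => N) (fun _ => hNn)
    exact hSadd _ (by simpa using this) _ hu
  have hNO : ∀ i, zc (N • s i + u) ∈ acone S := by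
    intro i
    rw [hNs, add_comm]
    exact ii_add huO (cone_smul (cone_of_mem (mem_image_of_mem zc (hs i))) hNp.le)
  refine ⟨Option ι, inferInstance, inferInstance,
    fun i => i.elim (δ - (∑ i, w i) / N) (fun i => w i / N),
    fun i => i.elim u (fun i => N • s i + u), ?_, ?_, ?_, ?_⟩
  · rintro (_ | i)
    · simp only [Option.elim, sub_pos]
      rw [div_lt_iff₀ hδ] at hN
      rw [div_lt_iff₀ hNp]
      linarith
    · exact div_pos (hw i) hNp
  · rintro (_ | i)
    · exact hu
    · exact hNS i
  · rintro (_ | i)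
    · exact huO
    · exact hNO i
  · rw [Fintype.sum_option]
    simp only [Option.elim]
    simp only [hNs, smul_add, smul_smul, Finset.sum_add_distrib, ← Finset.sum_smul,
      ← Finset.sum_div]
    have h2 : ∀ i, w i / N * N = w i := fun i => div_mul_cancel₀ _ hNp.ne'
    simp only [h2, ← e, sub_smul]
    abel

lemma gauge_sum {m : ℕ} {S : Set (Fin m → ℤ)} {g : (Fin m → ℝ) → EReal}
    (hsub : ∀ x ∈ acone S, ∀ y ∈ acone S, g (x + y) ≤ g x + g y)
    (hhom : ∀ x ∈ acone S, ∀ s : ℝ, 0 < s → g (s • x) = (s : EReal) * g x)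
    {ι : Type} [Fintype ι] [Nonempty ι] (w : ι → ℝ) (hw : ∀ i, 0 < w i)
    (s : ι → Fin m → ℝ) (hs : ∀ i, s i ∈ acone S) (M : ι → ℝ)
    (hM : ∀ i, g (s i) ≤ (M i : EReal)) :
    ∑ i, w i • s i ∈ acone S ∧ g (∑ i, w i • s i) ≤ ((∑ i, w i * M i : ℝ) : EReal) := by
  have key : (fun z : (Fin m → ℝ) × ℝ => z.1 ∈ acone S ∧ g z.1 ≤ (z.2 : EReal))
      (∑ i, (w i • s i, w i * M i)) := by
    refine Finset.sum_induction_nonempty (fun i => ((w i • s i, w i * M i) : (Fin m → ℝ) × ℝ))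
      (fun z : (Fin m → ℝ) × ℝ => z.1 ∈ acone S ∧ g z.1 ≤ (z.2 : EReal)) ?_
      Finset.univ_nonempty ?_
    · rintro a b ⟨ha, ha'⟩ ⟨hb, hb'⟩
      refine ⟨ii_add ha (intrinsicInterior_subset hb), (hsub _ ha _ hb).trans ?_⟩
      rw [Prod.snd_add, EReal.coe_add]
      exact add_le_add ha' hb'
    · intro i _
      refine ⟨ii_smul (hs i) (hw i), ?_⟩
      simp only
      rw [hhom _ (hs i) _ (hw i)]
      exact (ereal_scale (hw i) _ _).2 (hM i)
  simpa only [Prod.fst_sum, Prod.snd_sum] using key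

lemma gauge_le {m : ℕ} {S : Set (Fin m → ℤ)} (hSne : S.Nonempty)
    (hSadd : ∀ x ∈ S, ∀ y ∈ S, x + y ∈ S)
    {q : (Fin m → ℤ) → EReal} (hqtop : ∀ x ∈ S, q x ≠ ⊤) {g h : (Fin m → ℝ) → EReal}
    (hgq : ∀ x ∈ S, zc x ∈ acone S → g (zc x) = q x)
    (hgsub : ∀ x ∈ acone S, ∀ y ∈ acone S, g (x + y) ≤ g x + g y)
    (hghom : ∀ x ∈ acone S, ∀ s : ℝ, 0 < s → g (s • x) = (s : EReal) * g x)
    (hhq : ∀ x ∈ S, zc x ∈ acone S → h (zc x) = q x)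
    (hhsub : ∀ x ∈ acone S, ∀ y ∈ acone S, h (x + y) ≤ h x + h y)
    (hhhom : ∀ x ∈ acone S, ∀ s : ℝ, 0 < s → h (s • x) = (s : EReal) * h x)
    {x : Fin m → ℝ} (hx : x ∈ acone S) : g x ≤ h x := by
  obtain ⟨ι, _, _, w, s, hw, hs, hsO, e⟩ := acone_rep hSne hSadd hx
  have hM : ∀ i, ∃ M : ℝ, 0 ≤ M ∧ q (s i) ≤ (M : EReal) := by
    intro i
    refine ⟨max 0 (q (s i)).toReal, le_max_left _ _, (EReal.le_coe_toReal (hqtop _ (hs i))).trans ?_⟩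
    exact_mod_cast le_max_right _ _
  choose M hM0 hM using hM
  have hgM : ∀ i, g (zc (s i)) ≤ (M i : EReal) := fun i => by rw [hgq _ (hs i) (hsO i)]; exact hM i
  have hhM : ∀ i, h (zc (s i)) ≤ (M i : EReal) := fun i => by rw [hhq _ (hs i) (hsO i)]; exact hM i
  refine ereal_le_of fun r hr => ?_
  set D := ∑ i, w i * M i with hD
  have main : ∀ ε : ℝ, 0 < ε → ε < 1 → g x ≤ (((1 - ε) * r + ε * D + ε * D : ℝ) : EReal) := by
    intro ε hε hε1
    choose a ha ha' using fun i => exists_rat_btwn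
      (show (1 - ε) * w i < w i by nlinarith [hw i])
    have hap : ∀ i, 0 < (a i : ℝ) := fun i =>
      (mul_pos (sub_pos.2 hε1) (hw i)).trans (ha i)
    obtain ⟨N, n, hN, hn, hna⟩ := common_denom a (fun i => by exact_mod_cast hap i)
    have hnr : ∀ i, (n i : ℝ) = N * (a i : ℝ) := fun i => by exact_mod_cast hna i
    have hNp : (0 : ℝ) < N := by exact_mod_cast hN
    set y := ∑ i, (a i : ℝ) • zc (s i) with hy
    obtain ⟨hyO, -⟩ := gauge_sum hgsub hghom (fun i => (a i : ℝ)) hap _ hsO M hgM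
    have hNy : (N : ℝ) • y = zc (∑ i, n i • s i) := by
      rw [zc_sum, hy, Finset.smul_sum]
      simp only [hnr, mul_smul]
    have hgh : g y = h y := by
      apply ereal_scale_inj hNp
      have hO := ii_smul hyO hNp
      have hS := int_sum hSadd s hs n hn
      rw [← hghom y hyO N hNp, ← hhhom y hyO N hNp]
      change (N : ℝ) • y ∈ acone S at hO
      rw [hNy] at hO ⊢
      rw [hgq _ hS hO, hhq _ hS hO]
    obtain ⟨hzO, hz⟩ := gauge_sum hgsub hghom (fun i => w i - a i) (fun i => sub_pos.2 (ha' i))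
      _ hsO M hgM
    obtain ⟨hzO', hz'⟩ := gauge_sum hhsub hhhom (fun i => a i - (1 - ε) * w i)
      (fun i => sub_pos.2 (ha i)) _ hsO M hhM
    have hb1 : ∑ i, (w i - a i) * M i ≤ ε * D := by
      rw [hD, Finset.mul_sum]
      refine Finset.sum_le_sum fun i _ => ?_
      nlinarith [mul_le_mul_of_nonneg_right (ha i).le (hM0 i)]
    have hb2 : ∑ i, (a i - (1 - ε) * w i) * M i ≤ ε * D := by
      rw [hD, Finset.mul_sum]
      refine Finset.sum_le_sum fun i _ => ?_
      nlinarith [mul_le_mul_of_nonneg_right (ha' i).le (hM0 i)]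
    have hxO := ii_smul hx (sub_pos.2 hε1)
    have ex : x = y + ∑ i, (w i - a i) • zc (s i) := by
      rw [e, hy, ← Finset.sum_add_distrib]
      exact Finset.sum_congr rfl fun i _ => by rw [← add_smul]; congr 1; ring
    have ey : y = (1 - ε) • x + ∑ i, (a i - (1 - ε) * w i) • zc (s i) := by
      rw [e, hy, Finset.smul_sum, ← Finset.sum_add_distrib]
      exact Finset.sum_congr rfl fun i _ => by rw [smul_smul, ← add_smul]; congr 1; ring
    have h1 : h y ≤ (((1 - ε) * r + ε * D : ℝ) : EReal) := by
      rw [ey, EReal.coe_add]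
      refine (hhsub _ hxO _ hzO').trans (add_le_add ?_ (hz'.trans (by exact_mod_cast hb2)))
      rw [hhhom _ hx _ (sub_pos.2 hε1)]
      exact (ereal_scale (sub_pos.2 hε1) _ _).2 hr
    rw [ex, EReal.coe_add]
    exact (hgsub _ hyO _ hzO).trans (add_le_add (hgh ▸ h1) (hz.trans (by exact_mod_cast hb1)))
  have lim : Tendsto (fun ε : ℝ => (((1 - ε) * r + ε * D + ε * D : ℝ) : EReal)) (𝓝[>] 0)
      (𝓝 (r : EReal)) := by
    refine (continuous_coe_real_ereal.tendsto r).comp (tendsto_nhdsWithin_of_tendsto_nhds ?_)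
    have : Continuous fun ε : ℝ => (1 - ε) * r + ε * D + ε * D := by fun_prop
    simpa using this.tendsto 0
  refine ge_of_tendsto lim ?_
  filter_upwards [Ioo_mem_nhdsGT (zero_lt_one (α := ℝ))] with ε hε
  exact main ε hε.1 hε.2

/-- the restriction of a ℤ-gauge `q` on `S` to `O ∩ S` extends uniquely
to a gauge on the asymptotic cone `O`. -/
theorem stmt13 {m : ℕ} (S : Set (Fin m → ℤ)) (hSne : S.Nonempty)
    (hSadd : ∀ x ∈ S, ∀ y ∈ S, x + y ∈ S)
    (q : (Fin m → ℤ) → EReal) (hqtop : ∀ x ∈ S, q x ≠ ⊤)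
    (hqsub : ∀ x ∈ S, ∀ y ∈ S, q (x + y) ≤ q x + q y)
    (hqhom : ∀ x ∈ S, ∀ t : ℕ, 0 < t → q (t • x) = ((t : ℝ) : EReal) * q x) :
    ∃ qb : (Fin m → ℝ) → EReal,
      (∀ x ∈ S, zc x ∈ acone S → qb (zc x) = q x) ∧
      (∀ x ∈ acone S, qb x ≠ ⊤) ∧
      (∀ x ∈ acone S, ∀ y ∈ acone S, qb (x + y) ≤ qb x + qb y) ∧
      (∀ x ∈ acone S, ∀ s : ℝ, 0 < s → qb (s • x) = (s : EReal) * qb x) ∧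
      (∀ qb' : (Fin m → ℝ) → EReal,
        (∀ x ∈ S, zc x ∈ acone S → qb' (zc x) = q x) →
        (∀ x ∈ acone S, ∀ y ∈ acone S, qb' (x + y) ≤ qb' x + qb' y) →
        (∀ x ∈ acone S, ∀ s : ℝ, 0 < s → qb' (s • x) = (s : EReal) * qb' x) →
        ∀ x ∈ acone S, qb' x = qb x) := by
  classical
  let qb : (Fin m → ℝ) → EReal := fun x => sInf {e : EReal | ∃ r : ℝ, KK S q x r ∧ e = (r : EReal)}
  have qb_le : ∀ x r, KK S q x r → qb x ≤ (r : EReal) := fun x r h => sInf_le ⟨r, h, rfl⟩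
  have le_qb : ∀ x (c : EReal), (∀ r, KK S q x r → c ≤ (r : EReal)) → c ≤ qb x := by
    intro x c h
    refine le_sInf ?_
    rintro _ ⟨r, hr, rfl⟩
    exact h r hr
  have lt_qb : ∀ x (c : EReal), qb x < c → ∃ r : ℝ, KK S q x r ∧ (r : EReal) < c := by
    intro x c h
    obtain ⟨_, ⟨r, hr, rfl⟩, hlt⟩ := sInf_lt_iff.1 h
    exact ⟨r, hr, hlt⟩
  have hext : ∀ x ∈ S, zc x ∈ acone S → qb (zc x) = q x := by
    intro x hx _
    apply le_antisymm
    · refine ereal_le_of fun r hr => qb_le _ _ ?_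
      exact ⟨Unit, inferInstance, inferInstance, fun _ => 1, fun _ => x, fun _ => r,
        by simp, by simpa using hx, by simpa using hr, by simp, by simp⟩
    · exact le_qb _ _ fun r hr => KK_int hSadd hqsub hqhom hx hr
  have htop : ∀ x ∈ acone S, qb x ≠ ⊤ := by
    intro x hx
    obtain ⟨ι, _, _, w, s, hw, hs, hsO, e⟩ := acone_rep hSne hSadd hx
    exact ne_top_of_le_ne_top (EReal.coe_ne_top _) (qb_le x _
      ⟨ι, inferInstance, inferInstance, w, s, fun i => (q (s i)).toReal, hw, hs,
        fun i => EReal.le_coe_toReal (hqtop _ (hs i)), e, rfl⟩)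
  have hsub : ∀ x ∈ acone S, ∀ y ∈ acone S, qb (x + y) ≤ qb x + qb y := by
    intro x hx y hy
    refine EReal.le_add_of_forall_gt (Or.inr (htop y hy)) (Or.inl (htop x hx)) ?_
    intro a ha b hb
    obtain ⟨r, hr, hra⟩ := lt_qb _ _ ha
    obtain ⟨t, ht, htb⟩ := lt_qb _ _ hb
    refine (qb_le _ _ (hr.add ht)).trans ?_
    rw [EReal.coe_add]
    exact add_le_add hra.le htb.le
  have hhom : ∀ x ∈ acone S, ∀ s : ℝ, 0 < s → qb (s • x) = (s : EReal) * qb x := by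
    intro x hx s hs
    have aux : ∀ (x : Fin m → ℝ) (s : ℝ), 0 < s → ∀ r : ℝ, qb x ≤ (r : EReal) →
        qb (s • x) ≤ ((s * r : ℝ) : EReal) := by
      intro x s hs r hr
      refine EReal.le_of_forall_lt_iff_le.1 fun r' hr' => ?_
      have hr' : s * r < r' := by exact_mod_cast hr'
      have : qb x < ((r' / s : ℝ) : EReal) := hr.trans_lt (by
        rw [EReal.coe_lt_coe_iff, lt_div_iff₀ hs]; linarith)
      obtain ⟨t, ht, htb⟩ := lt_qb _ _ this
      refine (qb_le _ _ (ht.smul hs)).trans ?_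
      have htb : t < r' / s := by exact_mod_cast htb
      rw [lt_div_iff₀ hs] at htb
      rw [EReal.coe_le_coe_iff]
      linarith
    apply le_antisymm
    · refine ereal_le_of fun r hr => ?_
      have e : r = s * (r / s) := by field_simp
      rw [e] at hr ⊢
      exact aux x s hs _ ((ereal_scale hs _ _).1 hr)
    · refine ereal_le_of fun r hr => ?_
      have := aux (s • x) s⁻¹ (inv_pos.2 hs) r hr
      rw [inv_smul_smul₀ hs.ne'] at this
      have e : r = s * (s⁻¹ * r) := by field_simp
      rw [e]
      exact (ereal_scale hs _ _).2 this
  refine ⟨qb, hext, htop, hsub, hhom, ?_⟩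
  intro qb' h1 h2 h3 x hx
  exact le_antisymm (gauge_le hSne hSadd hqtop h1 h2 h3 hext hsub hhom hx)
    (gauge_le hSne hSadd hqtop hext hsub hhom h1 h2 h3 hx)
end
end
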